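/- Let G be a finitely generated group such that every group homomorphism G → ℤ is trivial. Then the following are equivalent: (1) for every uniformly convex isometric Banach G-module (X,π), H¹(G,X) = {0}; (2) for every uniformly convex isometric Banach G-module (X,π) with X^G = {0}, H̄¹(G,X) = {0}. Moreover, these conditions imply that G has property (T_{UC}): for every uniformly convex isometric Banach G-module (X,π), the induced isometric module (X/X^G, π̄) does not have almost invariant unit vectors. -/

import Mathlib

noncomputable section

open scoped BigOperators

universe u

section Defs

variable {G : Type*} [Group G] {X : Type*} [NormedAddCommGroup X] [NormedSpace ℝ X]

/-- The submodule `X^G` of `G`-invariant vectors. -/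
def invariants (π : G →* (X →L[ℝ] X)) : Submodule ℝ X where
  carrier := {x | ∀ g : G, π g x = x}
  add_mem' := by
    intro a b ha hb g
    simp [map_add, ha g, hb g]
  zero_mem' := by
    intro g
    simp
  smul_mem' := by
    intro c x hx g
    simp [map_smul, hx g]

/-- The induced action `π̄` of `G` on the quotient `X / X^G`,
`π̄(g)(x + X^G) = π(g)x + X^G`. -/
def pibar (π : G →* (X →L[ℝ] X)) (g : G) :
    (X ⧸ invariants π) →ₗ[ℝ] (X ⧸ invariants π) :=
  Submodule.mapQ (invariants π) (invariants π) (π g).toLinearMap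
    (by
      intro x hx
      intro h
      show π h (π g x) = π g x
      rw [hx g, hx h])

/-- The degree-1 cocycle condition; `Z¹(G,X)` is the set of such maps. -/
def IsCocycle (π : G →* (X →L[ℝ] X)) (φ : G → X) : Prop :=
  ∀ g f : G, φ (g * f) = π g (φ f) + φ g

/-- The coboundary `∂¹x = (g ↦ x - π(g)x)`; `B¹(G,X)` is the range of this map. -/
def cob1 (π : G →* (X →L[ℝ] X)) (x : X) : G → X := fun g => x - π g x

end Defs

variable (G : Type*) [Group G]

/-- Condition (1): every uniformly convex isometric Banach `G`-module has vanishing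
(unreduced) first cohomology. -/
def VanishingH1UC : Prop :=
  ∀ (X : Type u) [NormedAddCommGroup X] [NormedSpace ℝ X] [CompleteSpace X]
    [UniformConvexSpace X] (π : G →* (X →L[ℝ] X)),
    (∀ (g : G) (x : X), ‖π g x‖ = ‖x‖) →
    ∀ φ : G → X, IsCocycle π φ → ∃ x : X, φ = cob1 π x

/-- Condition (2): every uniformly convex isometric Banach `G`-module with `X^G = {0}`
has vanishing reduced first cohomology (closure in the topology of pointwise
convergence). -/
def VanishingReducedH1UC : Prop :=
  ∀ (X : Type u) [NormedAddCommGroup X] [NormedSpace ℝ X] [CompleteSpace X]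
    [UniformConvexSpace X] (π : G →* (X →L[ℝ] X)),
    (∀ (g : G) (x : X), ‖π g x‖ = ‖x‖) →
    (∀ x : X, (∀ g : G, π g x = x) → x = 0) →
    ∀ φ : G → X, IsCocycle π φ → φ ∈ closure (Set.range (cob1 π))

/-- Property `(T_{UC})`: for every uniformly convex isometric Banach `G`-module, the
induced module on `X/X^G` has no almost invariant unit vectors. -/
def PropertyTUC : Prop :=
  ∀ (X : Type u) [NormedAddCommGroup X] [NormedSpace ℝ X] [CompleteSpace X]
    [UniformConvexSpace X] (π : G →* (X →L[ℝ] X)),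
    (∀ (g : G) (x : X), ‖π g x‖ = ‖x‖) →
    ¬ (∀ (E : Finset G) (ε : ℝ), 0 < ε →
        ∃ v : X ⧸ invariants π, ‖v‖ = 1 ∧ ∀ g ∈ E, ‖v - pibar π g v‖ < ε)

section Cocycles

variable {G} {X : Type*} [NormedAddCommGroup X] [NormedSpace ℝ X]
  {π : G →* (X →L[ℝ] X)}

theorem IsCocycle.map_one {φ : G → X} (hφ : IsCocycle π φ) : φ 1 = 0 := by
  simpa using hφ 1 1

theorem IsCocycle.map_inv {φ : G → X} (hφ : IsCocycle π φ) (g : G) :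
    φ g⁻¹ = -π g⁻¹ (φ g) := by
  have h := hφ g⁻¹ g
  rw [inv_mul_cancel, hφ.map_one] at h
  exact eq_neg_of_add_eq_zero_right h.symm

theorem IsCocycle.sub {φ ψ : G → X} (hφ : IsCocycle π φ) (hψ : IsCocycle π ψ) :
    IsCocycle π (fun g => φ g - ψ g) := by
  intro g f
  simp only [hφ g f, hψ g f, map_sub]
  abel

theorem IsCocycle.smul {φ : G → X} (hφ : IsCocycle π φ) (c : ℝ) :
    IsCocycle π (fun g => c • φ g) := by
  intro g f
  simp only [hφ g f, map_smul, smul_add]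

theorem isCocycle_cob1 (π : G →* (X →L[ℝ] X)) (x : X) : IsCocycle π (cob1 π x) := by
  intro g f
  simp [cob1]

theorem IsCocycle.norm_mul_le {φ : G → X} (hφ : IsCocycle π φ)
    (hπ : ∀ (g : G) (x : X), ‖π g x‖ = ‖x‖) (g f : G) : ‖φ (g * f)‖ ≤ ‖φ f‖ + ‖φ g‖ := by
  rw [hφ g f]
  exact (norm_add_le _ _).trans_eq (by rw [hπ])

theorem IsCocycle.norm_inv {φ : G → X} (hφ : IsCocycle π φ)
    (hπ : ∀ (g : G) (x : X), ‖π g x‖ = ‖x‖) (g : G) : ‖φ g⁻¹‖ = ‖φ g‖ := by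
  rw [hφ.map_inv, norm_neg, hπ]

/-- The subgroup of elements along which a family of cocycles of an isometric module tends
to zero. -/
def tendstoZeroSubgroup {ι : Type*} (F : Filter ι) (φ : ι → G → X)
    (hφ : ∀ i, IsCocycle π (φ i)) (hπ : ∀ (g : G) (x : X), ‖π g x‖ = ‖x‖) : Subgroup G where
  carrier := {g | Filter.Tendsto (fun i => ‖φ i g‖) F (nhds 0)}
  one_mem' := by simp [(hφ _).map_one, tendsto_const_nhds]
  mul_mem' := by
    intro a b ha hb
    have h : Filter.Tendsto (fun i => ‖φ i b‖ + ‖φ i a‖) F (nhds 0) := by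
      simpa using Filter.Tendsto.add hb ha
    exact squeeze_zero (fun i => norm_nonneg _) (fun i => (hφ i).norm_mul_le hπ a b) h
  inv_mem' := by
    intro a ha
    simpa [(hφ _).norm_inv hπ] using ha

theorem mem_tendstoZeroSubgroup {ι : Type*} {F : Filter ι} {φ : ι → G → X}
    {hφ : ∀ i, IsCocycle π (φ i)} {hπ : ∀ (g : G) (x : X), ‖π g x‖ = ‖x‖} {g : G} :
    g ∈ tendstoZeroSubgroup F φ hφ hπ ↔ Filter.Tendsto (fun i => ‖φ i g‖) F (nhds 0) :=
  Iff.rfl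

theorem tendsto_zero_of_generators {ι : Type*} {F : Filter ι} {φ : ι → G → X}
    (hφ : ∀ i, IsCocycle π (φ i)) (hπ : ∀ (g : G) (x : X), ‖π g x‖ = ‖x‖)
    {S : Set G} (hS : Subgroup.closure S = ⊤)
    (h : ∀ s ∈ S, Filter.Tendsto (fun i => ‖φ i s‖) F (nhds 0)) (g : G) :
    Filter.Tendsto (fun i => ‖φ i g‖) F (nhds 0) := by
  have hle : Subgroup.closure S ≤ tendstoZeroSubgroup F φ hφ hπ :=
    (Subgroup.closure_le _).2 h
  exact hle (hS ▸ Subgroup.mem_top g)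

theorem IsCocycle.eq_zero_of_generators {φ : G → X} (hφ : IsCocycle π φ)
    (hπ : ∀ (g : G) (x : X), ‖π g x‖ = ‖x‖)
    {S : Set G} (hS : Subgroup.closure S = ⊤) (h : ∀ s ∈ S, φ s = 0) (g : G) : φ g = 0 := by
  have := tendsto_zero_of_generators (F := (Filter.atTop : Filter ℕ)) (φ := fun _ => φ)
    (fun _ => hφ) hπ hS (fun s hs => by simp [h s hs]) g
  simpa using tendsto_const_nhds_iff.1 this

theorem exists_bound_of_generators {ι : Type*} {φ : ι → G → X}
    (hφ : ∀ i, IsCocycle π (φ i)) (hπ : ∀ (g : G) (x : X), ‖π g x‖ = ‖x‖)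
    {S : Set G} (hS : Subgroup.closure S = ⊤)
    (h : ∀ s ∈ S, ∃ C, ∀ i, ‖φ i s‖ ≤ C) (g : G) : ∃ C, ∀ i, ‖φ i g‖ ≤ C := by
  have hg : g ∈ Subgroup.closure S := hS ▸ Subgroup.mem_top g
  induction hg using Subgroup.closure_induction with
  | mem s hs => exact h s hs
  | one => exact ⟨0, fun i => by simp [(hφ i).map_one]⟩
  | mul a b _ _ ha hb =>
    obtain ⟨A, hA⟩ := ha
    obtain ⟨B, hB⟩ := hb
    exact ⟨B + A, fun i => ((hφ i).norm_mul_le hπ a b).trans (add_le_add (hB i) (hA i))⟩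
  | inv a _ ha =>
    obtain ⟨A, hA⟩ := ha
    exact ⟨A, fun i => ((hφ i).norm_inv hπ a).trans_le (hA i)⟩

end Cocycles

section QuotientModule

variable {G} {X : Type*} [NormedAddCommGroup X] [NormedSpace ℝ X]
  {π : G →* (X →L[ℝ] X)}

theorem isClosed_invariants (π : G →* (X →L[ℝ] X)) : IsClosed (invariants π : Set X) := by
  have : (invariants π : Set X) = ⋂ g : G, {x | π g x = x} := by
    ext x
    simp [invariants]
  rw [this]
  exact isClosed_iInter fun g => isClosed_eq (π g).continuous continuous_id

theorem map_mem_invariants (g : G) (x : X) (hx : x ∈ invariants π) : π g x ∈ invariants π := by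
  rw [hx g]
  exact hx

/-- The action induced on the quotient of a module by an invariant submodule. -/
def quotientAction (π : G →* (X →L[ℝ] X)) (N : Submodule ℝ X)
    (hN : ∀ g, ∀ x ∈ N, π g x ∈ N) : G →* ((X ⧸ N) →L[ℝ] (X ⧸ N)) where
  toFun g :=
    { toLinearMap := N.mapQ N (π g).toLinearMap (hN g)
      cont := N.isOpenQuotientMap_mkQ.isQuotientMap.continuous_iff.2
        (N.isOpenQuotientMap_mkQ.continuous.comp (π g).continuous) }
  map_one' := by
    ext v
    induction v using Submodule.Quotient.induction_on
    simp
  map_mul' a b := by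
    ext v
    induction v using Submodule.Quotient.induction_on
    simp

theorem quotientAction_mk {N : Submodule ℝ X} {hN : ∀ g, ∀ x ∈ N, π g x ∈ N} (g : G) (x : X) :
    quotientAction π N hN g (Submodule.Quotient.mk x) = Submodule.Quotient.mk (π g x) :=
  rfl

theorem norm_quotientAction (hπ : ∀ (g : G) (x : X), ‖π g x‖ = ‖x‖) {N : Submodule ℝ X}
    {hN : ∀ g, ∀ x ∈ N, π g x ∈ N} (g : G) (v : X ⧸ N) :
    ‖quotientAction π N hN g v‖ = ‖v‖ := by
  have key : ∀ (g : G) (v : X ⧸ N), ‖quotientAction π N hN g v‖ ≤ ‖v‖ := by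
    intro g v
    refine le_of_forall_pos_lt_add fun ε hε => ?_
    obtain ⟨m, rfl, hm⟩ := Submodule.Quotient.norm_mk_lt v hε
    rw [quotientAction_mk]
    exact ((Submodule.Quotient.norm_mk_le _ _).trans_eq (hπ g m)).trans_lt hm
  refine le_antisymm (key g v) ?_
  have h := key g⁻¹ (quotientAction π N hN g v)
  rwa [← mul_apply_eq_comp, ← map_mul, inv_mul_cancel, map_one] at h

theorem cob1_quotientAction_mk {N : Submodule ℝ X} [IsClosed (N : Set X)]
    {hN : ∀ g, ∀ x ∈ N, π g x ∈ N} (x : X)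
    (g : G) : cob1 (quotientAction π N hN) (Submodule.Quotient.mk x) g
      = Submodule.Quotient.mk (cob1 π x g) :=
  rfl

theorem IsCocycle.mk {φ : G → X} (hφ : IsCocycle π φ) (N : Submodule ℝ X)
    [IsClosed (N : Set X)] (hN : ∀ g, ∀ x ∈ N, π g x ∈ N) :
    IsCocycle (quotientAction π N hN) (fun g => Submodule.Quotient.mk (φ g)) := by
  intro g f
  simp only [hφ g f, Submodule.Quotient.mk_add, quotientAction_mk]

theorem IsCocycle.norm_pow_sub_le {φ : G → X} (hφ : IsCocycle π φ)
    (hπ : ∀ (g : G) (x : X), ‖π g x‖ = ‖x‖) {c : X} (hc : c ∈ invariants π) (g : G) (n : ℕ) :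
    ‖φ (g ^ n) - (n : ℝ) • c‖ ≤ n * ‖φ g - c‖ := by
  induction n with
  | zero => simp [hφ.map_one]
  | succ n ih =>
    have : φ (g ^ (n + 1)) - ((n + 1 : ℕ) : ℝ) • c
        = π g (φ (g ^ n) - (n : ℝ) • c) + (φ g - c) := by
      rw [pow_succ', hφ, map_sub, map_smul, hc g]
      push_cast
      rw [add_smul, one_smul]
      abel
    rw [this]
    refine (norm_add_le _ _).trans ?_
    rw [hπ]
    push_cast
    linarith

/-- A vector whose translates differ from it by invariant vectors is invariant. -/
theorem invariant_of_sub_mem_invariants (hπ : ∀ (g : G) (x : X), ‖π g x‖ = ‖x‖) {x : X}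
    (h : ∀ g, cob1 π x g ∈ invariants π) : x ∈ invariants π := by
  intro g
  have hb : ∀ n : ℕ, n * ‖cob1 π x g‖ ≤ 2 * ‖x‖ := by
    intro n
    have h1 := (isCocycle_cob1 π x).norm_pow_sub_le hπ (h g) g n
    rw [sub_self, norm_zero, mul_zero, norm_le_zero_iff, sub_eq_zero] at h1
    have h2 : ‖cob1 π x (g ^ n)‖ ≤ ‖x‖ + ‖x‖ := (norm_sub_le _ _).trans_eq (by rw [hπ])
    rw [h1, norm_smul, Real.norm_natCast] at h2
    linarith
  have h0 : ‖cob1 π x g‖ ≤ 0 := by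
    by_contra! hpos
    obtain ⟨n, hn⟩ := exists_nat_gt (2 * ‖x‖ / ‖cob1 π x g‖)
    rw [div_lt_iff₀ hpos] at hn
    exact absurd (hb n) (not_le.2 hn)
  exact (sub_eq_zero.1 (norm_le_zero_iff.1 h0)).symm

theorem eq_zero_of_invariant_quotientAction (hπ : ∀ (g : G) (x : X), ‖π g x‖ = ‖x‖)
    (v : X ⧸ invariants π)
    (hv : ∀ g, quotientAction π (invariants π) map_mem_invariants g v = v) : v = 0 := by
  induction v using Submodule.Quotient.induction_on with
  | H x =>
    rw [Submodule.Quotient.mk_eq_zero]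
    refine invariant_of_sub_mem_invariants hπ fun g => ?_
    exact (Submodule.Quotient.eq _).1 (hv g).symm

end QuotientModule

section Abelianization

variable {G}

theorem exists_pow_mem_commutator (S : Finset G) (hS : Subgroup.closure (S : Set G) = ⊤)
    (hnoZ : ∀ c : G → ℤ, (∀ a b : G, c (a * b) = c a + c b) → c = 0) (g : G) :
    ∃ n : ℕ, 0 < n ∧ g ^ n ∈ commutator G := by
  have hG : Group.FG G := ⟨S, hS⟩
  have hfgA : Group.FG (Abelianization G) :=
    Group.fg_of_surjective (f := Abelianization.of) (QuotientGroup.mk_surjective)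
  have : AddGroup.FG (Additive (Abelianization G)) := inferInstance
  have : Module.Finite ℤ (Additive (Abelianization G)) := Module.Finite.iff_addGroup_fg.2 this
  let T := Submodule.torsion ℤ (Additive (Abelianization G))
  let q : Additive (Abelianization G) →ₗ[ℤ] Additive (Abelianization G) ⧸ T := T.mkQ
  let b := Module.Free.chooseBasis ℤ (Additive (Abelianization G) ⧸ T)
  have hz : q (Additive.ofMul (Abelianization.of g)) = 0 := by
    refine b.repr.map_eq_zero_iff.1 (Finsupp.ext fun i => ?_)
    have := hnoZ (fun g => b.repr (q (Additive.ofMul (Abelianization.of g))) i) (by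
      intro x y
      simp)
    exact congrFun this g
  rw [Submodule.mkQ_apply, Submodule.Quotient.mk_eq_zero] at hz
  obtain ⟨a, ha⟩ := hz
  have ha0 : (a : ℤ) ≠ 0 := nonZeroDivisors.coe_ne_zero a
  have hzpow : (Abelianization.of g) ^ (a : ℤ) = 1 := ha
  refine ⟨(a : ℤ).natAbs, Int.natAbs_pos.2 ha0, ?_⟩
  have : Abelianization.of (g ^ (a : ℤ).natAbs) = 1 := by
    rw [map_pow]
    exact pow_natAbs_eq_one.2 hzpow
  exact (QuotientGroup.eq_one_iff _).1 this

end Abelianization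

section Lifting

open scoped commutatorElement

variable {G} {X : Type*} [NormedAddCommGroup X] [NormedSpace ℝ X]
  {π : G →* (X →L[ℝ] X)}

theorem IsCocycle.norm_commutator_le {φ : G → X} (hφ : IsCocycle π φ)
    (hπ : ∀ (g : G) (x : X), ‖π g x‖ = ‖x‖) {c d : X} (hc : c ∈ invariants π)
    (hd : d ∈ invariants π) (g h : G) :
    ‖φ ⁅g, h⁆‖ ≤ 2 * (‖φ g - c‖ + ‖φ h - d‖) := by
  have h1 : φ (⁅g, h⁆ * (h * g)) = φ (g * h) := by
    congr 1
    simp [commutatorElement_def, mul_assoc]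
  rw [hφ ⁅g, h⁆, hφ h g, hφ g h] at h1
  have h2 : φ ⁅g, h⁆ = (π g (φ h - d) + (φ g - c))
      - π ⁅g, h⁆ (π h (φ g - c) + (φ h - d)) := by
    simp only [map_add, map_sub, hc _, hd _] at h1 ⊢
    rw [← eq_sub_iff_add_eq'] at h1
    rw [h1]
    abel
  rw [h2]
  refine (norm_sub_le _ _).trans ?_
  rw [hπ]
  have h3 := norm_add_le (π g (φ h - d)) (φ g - c)
  have h4 := norm_add_le (π h (φ g - c)) (φ h - d)
  rw [hπ] at h3 h4
  linarith

theorem exists_invariant_norm_sub_le (x : X) :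
    ∃ c ∈ invariants π, ‖x - c‖ ≤ 2 * ‖(Submodule.Quotient.mk x : X ⧸ invariants π)‖ := by
  have := isClosed_invariants π
  rcases (norm_nonneg (Submodule.Quotient.mk x : X ⧸ invariants π)).eq_or_lt with h | h
  · refine ⟨x, (Submodule.Quotient.mk_eq_zero _).1 (norm_eq_zero.1 h.symm), by simp⟩
  · obtain ⟨m, hm, hlt⟩ := Submodule.Quotient.norm_mk_lt
      (Submodule.Quotient.mk x : X ⧸ invariants π) h
    refine ⟨x - m, (Submodule.Quotient.eq _).1 hm.symm, ?_⟩
    rw [sub_sub_cancel]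
    linarith

/-- If the abelianization is torsion, a family of cocycles tending to zero modulo the invariant
vectors tends to zero. -/
theorem tendsto_zero_of_tendsto_mk (hπ : ∀ (g : G) (x : X), ‖π g x‖ = ‖x‖)
    (htor : ∀ g : G, ∃ n : ℕ, 0 < n ∧ g ^ n ∈ commutator G)
    {ι : Type*} {F : Filter ι} {φ : ι → G → X} (hφ : ∀ i, IsCocycle π (φ i))
    (h : ∀ g, Filter.Tendsto
      (fun i => ‖(Submodule.Quotient.mk (φ i g) : X ⧸ invariants π)‖) F (nhds 0)) (g : G) :
    Filter.Tendsto (fun i => ‖φ i g‖) F (nhds 0) := by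
  choose c hc hle using fun x : X => exists_invariant_norm_sub_le (π := π) x
  have he : ∀ g, Filter.Tendsto (fun i => ‖φ i g - c (φ i g)‖) F (nhds 0) := fun g =>
    squeeze_zero (fun i => norm_nonneg _) (fun i => hle _) (by simpa using (h g).const_mul 2)
  have hcomm : commutator G ≤ tendstoZeroSubgroup F φ hφ hπ := by
    rw [commutator_def, Subgroup.commutator_le]
    intro a _ b _
    refine squeeze_zero (fun i => norm_nonneg _)
      (fun i => (hφ i).norm_commutator_le hπ (hc (φ i a)) (hc (φ i b)) a b) ?_
    simpa using ((he a).add (he b)).const_mul 2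
  obtain ⟨n, hn, hmem⟩ := htor g
  have hlim : Filter.Tendsto (fun i => 2 * ‖φ i g - c (φ i g)‖ + ‖φ i (g ^ n)‖) F (nhds 0) := by
    simpa using ((he g).const_mul 2).add (mem_tendstoZeroSubgroup.1 (hcomm hmem))
  refine squeeze_zero (fun i => norm_nonneg _) (fun i => ?_) hlim
  have h1 := (hφ i).norm_pow_sub_le hπ (hc (φ i g)) g n
  have hn1 : (1 : ℝ) ≤ n := by exact_mod_cast hn
  have h2 : n * ‖c (φ i g)‖ ≤ ‖φ i (g ^ n)‖ + n * ‖φ i g - c (φ i g)‖ := by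
    calc n * ‖c (φ i g)‖ = ‖φ i (g ^ n) - (φ i (g ^ n) - (n : ℝ) • c (φ i g))‖ := by
          rw [sub_sub_cancel, norm_smul, Real.norm_natCast]
      _ ≤ _ := (norm_sub_le _ _).trans (by linarith)
  have h3 : ‖c (φ i g)‖ ≤ ‖φ i (g ^ n)‖ + ‖φ i g - c (φ i g)‖ := by
    refine le_of_mul_le_mul_left (h2.trans ?_) (by linarith : (0 : ℝ) < n)
    nlinarith [norm_nonneg (φ i (g ^ n))]
  have h4 := norm_add_le (φ i g - c (φ i g)) (c (φ i g))
  rw [sub_add_cancel] at h4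
  linarith

end Lifting

section UniformConvexity

theorem exists_norm_add_le_of_norm_le_one_add (X : Type*) [NormedAddCommGroup X]
    [NormedSpace ℝ X] [UniformConvexSpace X] {ε : ℝ} (hε : 0 < ε) :
    ∃ δ > 0, ∃ η > 0, ∀ x y : X, ‖x‖ ≤ 1 + η → ‖y‖ ≤ 1 + η → ε ≤ ‖x - y‖ →
      ‖x + y‖ ≤ 2 - δ := by
  obtain ⟨δ, hδ, h⟩ := exists_forall_closed_ball_dist_add_le_two_sub X (half_pos hε)
  refine ⟨δ / 2, half_pos hδ, min 1 (δ / 4), lt_min one_pos (by linarith), ?_⟩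
  intro x y hx hy hxy
  set η := min 1 (δ / 4) with hη
  have hη0 : 0 < η := lt_min one_pos (by linarith)
  have hη1 : η ≤ 1 := min_le_left _ _
  have hη2 : η ≤ δ / 4 := min_le_right _ _
  have hpos : 0 < 1 + η := by linarith
  have hnorm : ∀ z : X, ‖(1 + η)⁻¹ • z‖ = (1 + η)⁻¹ * ‖z‖ := fun z => by
    rw [norm_smul, norm_inv, Real.norm_of_nonneg hpos.le]
  have h1 : ∀ z : X, ‖z‖ ≤ 1 + η → ‖(1 + η)⁻¹ • z‖ ≤ 1 := fun z hz => by
    rw [hnorm, inv_mul_le_iff₀ hpos]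
    linarith
  have h2 := h (h1 x hx) (h1 y hy) (by
    rw [← smul_sub, hnorm, le_inv_mul_iff₀ hpos]
    nlinarith)
  rw [← smul_add, hnorm, inv_mul_le_iff₀ hpos] at h2
  nlinarith

theorem uniformConvexSpace_quotient {X : Type*} [NormedAddCommGroup X] [NormedSpace ℝ X]
    [UniformConvexSpace X] (N : Submodule ℝ X) [IsClosed (N : Set X)] :
    UniformConvexSpace (X ⧸ N) where
  uniform_convex := by
    intro ε hε
    obtain ⟨δ, hδ, η, hη, h⟩ := exists_norm_add_le_of_norm_le_one_add X hε
    refine ⟨δ, hδ, fun v hv w hw hvw => ?_⟩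
    obtain ⟨x, rfl, hx⟩ := Submodule.Quotient.norm_mk_lt v hη
    obtain ⟨y, rfl, hy⟩ := Submodule.Quotient.norm_mk_lt w hη
    rw [hv] at hx
    rw [hw] at hy
    exact (Submodule.Quotient.norm_mk_le N (x + y)).trans
      (h x y hx.le hy.le (hvw.trans (Submodule.Quotient.norm_mk_le N (x - y))))

end UniformConvexity

section Ultrapower

open scoped BoundedContinuousFunction

variable {X : Type*} [NormedAddCommGroup X] [NormedSpace ℝ X]

/-- The bounded sequences tending to zero along a filter; the quotient of the bounded sequences
by this subspace is the ultrapower when the filter is an ultrafilter. -/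
def nullSequences (X : Type*) [NormedAddCommGroup X] [NormedSpace ℝ X] (ω : Filter ℕ) :
    Submodule ℝ (ℕ →ᵇ X) where
  carrier := {u | Filter.Tendsto (fun n => u n) ω (nhds 0)}
  add_mem' := by
    intro u v hu hv
    simpa using Filter.Tendsto.add hu hv
  zero_mem' := by simp [tendsto_const_nhds]
  smul_mem' := by
    intro c u hu
    simpa using Filter.Tendsto.const_smul hu c

theorem mem_nullSequences_iff {ω : Filter ℕ} {u : ℕ →ᵇ X} :
    u ∈ nullSequences X ω ↔ ∀ ε > 0, ∀ᶠ n in ω, ‖u n‖ < ε := by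
  change Filter.Tendsto (fun n => u n) ω (nhds 0) ↔ _
  simp [Metric.tendsto_nhds]

theorem isClosed_nullSequences (ω : Filter ℕ) :
    IsClosed (nullSequences X ω : Set (ℕ →ᵇ X)) := by
  refine isClosed_of_closure_subset fun u hu => mem_nullSequences_iff.2 fun ε hε => ?_
  obtain ⟨v, hv, huv⟩ := Metric.mem_closure_iff.1 hu (ε / 2) (half_pos hε)
  filter_upwards [mem_nullSequences_iff.1 hv (ε / 2) (half_pos hε)] with n hn
  have h1 : ‖u n - v n‖ < ε / 2 := by
    rw [← dist_eq_norm]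
    exact (BoundedContinuousFunction.dist_coe_le_dist n).trans_lt huv
  have h2 := norm_add_le (u n - v n) (v n)
  rw [sub_add_cancel] at h2
  linarith

theorem norm_mk_le_of_eventually {ω : Filter ℕ} [ω.NeBot] {u : ℕ →ᵇ X} {r : ℝ}
    (h : ∀ᶠ n in ω, ‖u n‖ ≤ r) :
    ‖(Submodule.Quotient.mk u : (ℕ →ᵇ X) ⧸ nullSequences X ω)‖ ≤ r := by
  classical
  obtain ⟨m, hm⟩ := h.exists
  have hr : 0 ≤ r := (norm_nonneg _).trans hm
  let v : ℕ →ᵇ X := BoundedContinuousFunction.ofNormedAddCommGroupDiscrete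
    (fun n => if ‖u n‖ ≤ r then u n else 0) r (by
      intro n
      split_ifs with hn
      · exact hn
      · simpa using hr)
  have hv : ∀ n, v n = if ‖u n‖ ≤ r then u n else 0 := fun n => rfl
  have huv : (Submodule.Quotient.mk u : (ℕ →ᵇ X) ⧸ nullSequences X ω)
      = Submodule.Quotient.mk v := by
    rw [Submodule.Quotient.eq, mem_nullSequences_iff]
    intro ε hε
    filter_upwards [h] with n hn
    simpa [hv, hn] using hε
  rw [huv]
  refine (Submodule.Quotient.norm_mk_le _ v).trans ((BoundedContinuousFunction.norm_le hr).2 ?_)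
  intro n
  rw [hv]
  split_ifs with hn
  · exact hn
  · simpa using hr

theorem eventually_norm_lt_of_norm_mk_lt {ω : Filter ℕ} {u : ℕ →ᵇ X} {r : ℝ}
    (h : ‖(Submodule.Quotient.mk u : (ℕ →ᵇ X) ⧸ nullSequences X ω)‖ < r) :
    ∀ᶠ n in ω, ‖u n‖ < r := by
  obtain ⟨v, hv, hlt⟩ := Submodule.Quotient.norm_mk_lt
    (Submodule.Quotient.mk u : (ℕ →ᵇ X) ⧸ nullSequences X ω) (sub_pos.2 h)
  rw [add_sub_cancel] at hlt
  have hmem := (Submodule.Quotient.eq _).1 hv.symm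
  filter_upwards [mem_nullSequences_iff.1 hmem (r - ‖v‖) (sub_pos.2 hlt)] with n hn
  rw [BoundedContinuousFunction.sub_apply] at hn
  have h1 := norm_add_le (u n - v n) (v n)
  rw [sub_add_cancel] at h1
  linarith [v.norm_coe_le_norm n]

theorem uniformConvexSpace_ultrapower [UniformConvexSpace X] (ω : Ultrafilter ℕ)
    [IsClosed (nullSequences X ω : Set (ℕ →ᵇ X))] :
    UniformConvexSpace ((ℕ →ᵇ X) ⧸ nullSequences X ω) where
  uniform_convex := by
    intro ε hε
    obtain ⟨δ, hδ, η, hη, h⟩ := exists_norm_add_le_of_norm_le_one_add X (half_pos hε)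
    refine ⟨δ, hδ, fun v hv w hw hvw => ?_⟩
    induction v using Submodule.Quotient.induction_on with
    | H x =>
    induction w using Submodule.Quotient.induction_on with
    | H y =>
    have hx := eventually_norm_lt_of_norm_mk_lt (hv.trans_lt (lt_add_of_pos_right 1 hη))
    have hy := eventually_norm_lt_of_norm_mk_lt (hw.trans_lt (lt_add_of_pos_right 1 hη))
    have hxy : ∀ᶠ n in (ω : Filter ℕ), ¬ ‖(x - y) n‖ ≤ ε / 2 := by
      rw [Ultrafilter.eventually_not]
      intro hle
      have := hvw.trans (norm_mk_le_of_eventually hle)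
      linarith
    refine norm_mk_le_of_eventually (u := x + y) ?_
    filter_upwards [hx, hy, hxy] with n h1 h2 h3
    exact h _ _ h1.le h2.le (not_le.1 h3).le

/-- The coordinatewise action on bounded sequences. -/
def sequenceAction {G : Type*} [Group G] (π : G →* (X →L[ℝ] X)) :
    G →* ((ℕ →ᵇ X) →L[ℝ] (ℕ →ᵇ X)) where
  toFun g := (π g).compLeftContinuousBounded ℕ
  map_one' := by
    ext u n
    simp
  map_mul' a b := by
    ext u n
    simp

theorem sequenceAction_apply {G : Type*} [Group G] (π : G →* (X →L[ℝ] X)) (g : G) (u : ℕ →ᵇ X)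
    (n : ℕ) : sequenceAction π g u n = π g (u n) :=
  rfl

theorem norm_sequenceAction {G : Type*} [Group G] {π : G →* (X →L[ℝ] X)}
    (hπ : ∀ (g : G) (x : X), ‖π g x‖ = ‖x‖) (g : G) (u : ℕ →ᵇ X) :
    ‖sequenceAction π g u‖ = ‖u‖ := by
  have h : ∀ C : ℝ, 0 ≤ C → (‖sequenceAction π g u‖ ≤ C ↔ ‖u‖ ≤ C) := fun C hC => by
    simp only [BoundedContinuousFunction.norm_le hC, sequenceAction_apply, hπ]
  exact le_antisymm ((h _ (norm_nonneg _)).2 le_rfl) ((h _ (norm_nonneg _)).1 le_rfl)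

theorem map_mem_nullSequences {G : Type*} [Group G] {π : G →* (X →L[ℝ] X)}
    (hπ : ∀ (g : G) (x : X), ‖π g x‖ = ‖x‖) {ω : Filter ℕ} (g : G) (u : ℕ →ᵇ X)
    (hu : u ∈ nullSequences X ω) : sequenceAction π g u ∈ nullSequences X ω := by
  rw [mem_nullSequences_iff] at hu ⊢
  simpa only [sequenceAction_apply, hπ] using hu

end Ultrapower

section Rescaling

/-- If a positive continuous function on a complete space has no zero, then at each scale there is
a point near which it does not drop by more than half. -/
theorem exists_half_le_on_ball {X : Type*} [NormedAddCommGroup X] [CompleteSpace X] {F : X → ℝ}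
    (hF : Continuous F) (hpos : ∀ x, 0 < F x) (R : ℝ) :
    ∃ y, ∀ z, ‖z - y‖ ≤ R * F y → F y / 2 ≤ F z := by
  by_contra! hcon
  choose f hf hlt using hcon
  let u : ℕ → X := fun n => f^[n] 0
  have hu : ∀ n, u (n + 1) = f (u n) := fun n => Function.iterate_succ_apply' f n 0
  have hR : 0 ≤ R := nonneg_of_mul_nonneg_left ((norm_nonneg _).trans (hf 0)) (hpos 0)
  have hdecay : ∀ n, F (u n) ≤ F 0 / 2 ^ n := by
    intro n
    induction n with
    | zero => simp [u]
    | succ n ih =>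
      rw [hu, pow_succ, ← div_div]
      linarith [hlt (u n)]
  have hcauchy : CauchySeq u := by
    refine cauchySeq_of_le_geometric_two (C := 2 * (R * F 0)) fun n => ?_
    rw [dist_comm, dist_eq_norm, hu]
    calc ‖f (u n) - u n‖ ≤ R * F (u n) := hf _
      _ ≤ R * (F 0 / 2 ^ n) := mul_le_mul_of_nonneg_left (hdecay n) hR
      _ = 2 * (R * F 0) / 2 / 2 ^ n := by ring
  obtain ⟨x, hx⟩ := cauchySeq_tendsto_of_complete hcauchy
  have h0 : Filter.Tendsto (fun n : ℕ => F 0 / 2 ^ n) Filter.atTop (nhds 0) :=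
    tendsto_const_nhds.div_atTop (tendsto_pow_atTop_atTop_of_one_lt one_lt_two)
  exact (hpos x).not_ge (le_of_tendsto_of_tendsto' ((hF.tendsto x).comp hx) h0 hdecay)

end Rescaling

section FiniteSets

variable {G} {X : Type*} [NormedAddCommGroup X] [NormedSpace ℝ X] {π : G →* (X →L[ℝ] X)}

/-- The total displacement over a finite set of the affine action given by a cocycle. -/
def displacement (π : G →* (X →L[ℝ] X)) (φ : G → X) (S : Finset G) (x : X) : ℝ :=
  ∑ s ∈ S, ‖φ s - cob1 π x s‖

theorem displacement_smul_add {φ : G → X} {S : Finset G} {r : ℝ} (hr : 0 < r) (y z : X) :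
    displacement π φ S (y + r • z)
      = r * displacement π (fun g => r⁻¹ • (φ g - cob1 π y g)) S z := by
  simp only [displacement, Finset.mul_sum]
  refine Finset.sum_congr rfl fun s _ => ?_
  rw [← Real.norm_of_nonneg hr.le, ← norm_smul, Real.norm_of_nonneg hr.le, smul_sub,
    smul_inv_smul₀ hr.ne']
  congr 1
  simp only [cob1, map_add, map_smul, smul_sub]
  abel

/-- The coboundary map restricted to a finite set, as a continuous linear map. -/
def coboundaryOn (π : G →* (X →L[ℝ] X)) (S : Finset G) : X →L[ℝ] (S → X) :=
  ContinuousLinearMap.pi fun s => ContinuousLinearMap.id ℝ X - π s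

theorem coboundaryOn_apply (S : Finset G) (x : X) (s : S) :
    coboundaryOn π S x s = cob1 π x s :=
  rfl

end FiniteSets

section Vanishing

open scoped BoundedContinuousFunction

variable {G} {X : Type u} [NormedAddCommGroup X] [NormedSpace ℝ X] [CompleteSpace X]
  [UniformConvexSpace X] {π : G →* (X →L[ℝ] X)}

/-- Vanishing of reduced cohomology for modules without invariant vectors extends to all modules
when the abelianization is torsion. -/
theorem VanishingReducedH1UC.mem_closure (h : VanishingReducedH1UC.{u} G)
    (htor : ∀ g : G, ∃ n : ℕ, 0 < n ∧ g ^ n ∈ commutator G)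
    (hπ : ∀ (g : G) (x : X), ‖π g x‖ = ‖x‖) {φ : G → X} (hφ : IsCocycle π φ) :
    φ ∈ closure (Set.range (cob1 π)) := by
  have := isClosed_invariants π
  have := uniformConvexSpace_quotient (invariants π)
  let ρ := quotientAction π (invariants π) map_mem_invariants
  have hmem := h (X ⧸ invariants π) ρ (norm_quotientAction hπ)
    (eq_zero_of_invariant_quotientAction hπ) _ (hφ.mk (invariants π) map_mem_invariants)
  rw [mem_closure_iff_comap_neBot] at hmem
  have hlift : ∀ ψ : Set.range (cob1 ρ), ∃ x : X, ∀ g,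
      Submodule.Quotient.mk (cob1 π x g) = ψ.1 g := by
    rintro ⟨_, v, rfl⟩
    induction v using Submodule.Quotient.induction_on with
    | H x => exact ⟨x, fun g => rfl⟩
  choose x hx using hlift
  have hlim := tendsto_zero_of_tendsto_mk hπ htor
    (F := Filter.comap Subtype.val (nhds fun g => Submodule.Quotient.mk (φ g)))
    (φ := fun (ψ : Set.range (cob1 ρ)) g => φ g - cob1 π (x ψ) g)
    (fun ψ => hφ.sub (isCocycle_cob1 π (x ψ))) (by
      intro g
      have h1 := tendsto_pi_nhds.1 (Filter.tendsto_comap (f := Subtype.val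
        (p := fun ψ => ψ ∈ Set.range (cob1 ρ)))
        (x := nhds fun g => Submodule.Quotient.mk (φ g))) g
      have h2 := tendsto_iff_norm_sub_tendsto_zero.1 h1
      refine h2.congr fun ψ => ?_
      rw [← hx ψ g, norm_sub_rev, Submodule.Quotient.mk_sub])
  refine mem_closure_of_tendsto (b := Filter.comap Subtype.val
      (nhds fun g => (Submodule.Quotient.mk (φ g) : X ⧸ invariants π)))
    (f := fun ψ => cob1 π (x ψ)) (tendsto_pi_nhds.2 fun g => ?_)
    (Filter.Eventually.of_forall fun ψ => ⟨x ψ, rfl⟩)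
  refine tendsto_iff_norm_sub_tendsto_zero.2 ((hlim g).congr fun ψ => ?_)
  rw [norm_sub_rev]

theorem VanishingReducedH1UC.exists_norm_sub_cob1_lt (h : VanishingReducedH1UC.{u} G)
    (htor : ∀ g : G, ∃ n : ℕ, 0 < n ∧ g ^ n ∈ commutator G)
    (hπ : ∀ (g : G) (x : X), ‖π g x‖ = ‖x‖) {φ : G → X} (hφ : IsCocycle π φ)
    (S : Finset G) {ε : ℝ} (hε : 0 < ε) : ∃ x, ∀ s ∈ S, ‖φ s - cob1 π x s‖ < ε := by
  have hev : ∀ᶠ ξ in nhds φ, ∀ s ∈ S, dist (ξ s) (φ s) < ε := by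
    rw [Filter.eventually_all_finset]
    intro s _
    exact ((continuous_apply s).tendsto φ).eventually (Metric.ball_mem_nhds (φ s) hε)
  obtain ⟨_, hξ, x, rfl⟩ := mem_closure_iff_nhds.1 (h.mem_closure htor hπ hφ) _ hev
  refine ⟨x, fun s hs => ?_⟩
  rw [norm_sub_rev, ← dist_eq_norm]
  exact hξ s hs

theorem VanishingReducedH1UC.exists_eventually_norm_sub_cob1_lt (h : VanishingReducedH1UC.{u} G)
    (htor : ∀ g : G, ∃ n : ℕ, 0 < n ∧ g ^ n ∈ commutator G)
    (hπ : ∀ (g : G) (x : X), ‖π g x‖ = ‖x‖) {ψ : ℕ → G → X} (hψ : ∀ n, IsCocycle π (ψ n))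
    (hbound : ∀ g, ∃ C, ∀ n, ‖ψ n g‖ ≤ C) (S : Finset G) {ε : ℝ} (hε : 0 < ε)
    (ω : Ultrafilter ℕ) : ∃ z : ℕ →ᵇ X, ∀ᶠ n in (ω : Filter ℕ),
      ∀ s ∈ S, ‖ψ n s - cob1 π (z n) s‖ < ε := by
  choose C hC using hbound
  obtain ⟨Ψ, hΨψ⟩ : ∃ Ψ : G → (ℕ →ᵇ X), ∀ g n, Ψ g n = ψ n g :=
    ⟨fun g => BoundedContinuousFunction.ofNormedAddCommGroupDiscrete (fun n => ψ n g) (C g)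
      (hC g), fun g n => rfl⟩
  have hΨ : IsCocycle (sequenceAction π) Ψ := by
    intro g f
    ext n
    rw [BoundedContinuousFunction.add_apply, sequenceAction_apply, hΨψ, hΨψ, hΨψ, hψ n g f]
  have hclosed := isClosed_nullSequences (X := X) ω
  have := uniformConvexSpace_ultrapower (X := X) ω
  have hN : ∀ g, ∀ u ∈ nullSequences X ω, sequenceAction π g u ∈ nullSequences X ω :=
    map_mem_nullSequences hπ
  have hcoc := hΨ.mk (nullSequences X ω) hN
  have hnorm := norm_sequenceAction hπ
  have hiso : ∀ g v, ‖quotientAction (sequenceAction π) (nullSequences X ω) hN g v‖ = ‖v‖ :=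
    fun g v => norm_quotientAction hnorm g v
  obtain ⟨v, hv⟩ := h.exists_norm_sub_cob1_lt htor hiso hcoc S hε
  obtain ⟨z, rfl⟩ := Submodule.Quotient.mk_surjective _ v
  refine ⟨z, ?_⟩
  rw [Filter.eventually_all_finset]
  intro s hs
  have h1 := hv s hs
  rw [cob1_quotientAction_mk, ← Submodule.Quotient.mk_sub] at h1
  filter_upwards [eventually_norm_lt_of_norm_mk_lt h1] with n hn
  rwa [BoundedContinuousFunction.sub_apply, hΨψ] at hn

theorem VanishingReducedH1UC.vanishingH1UC (h : VanishingReducedH1UC.{u} G)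
    (htor : ∀ g : G, ∃ n : ℕ, 0 < n ∧ g ^ n ∈ commutator G)
    (S : Finset G) (hS : Subgroup.closure (S : Set G) = ⊤) : VanishingH1UC.{u} G := by
  intro X _ _ _ _ π hπ φ hφ
  by_contra! hcon
  have hpos : ∀ x, 0 < displacement π φ S x := by
    intro x
    refine (Finset.sum_nonneg fun s _ => norm_nonneg _).lt_of_ne fun h0 => hcon x ?_
    have h1 := (Finset.sum_eq_zero_iff_of_nonneg fun s _ => norm_nonneg _).1 h0.symm
    funext g
    exact sub_eq_zero.1 ((hφ.sub (isCocycle_cob1 π x)).eq_zero_of_generators hπ hS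
      (fun s hs => norm_eq_zero.1 (h1 s hs)) g)
  have hcont : Continuous (displacement π φ S) := by
    unfold displacement cob1
    fun_prop
  choose y hy using fun n : ℕ => exists_half_le_on_ball hcont hpos n
  set r : ℕ → ℝ := fun n => displacement π φ S (y n) with hr
  have hrpos : ∀ n, 0 < r n := fun n => hpos _
  let ψ : ℕ → G → X := fun n g => (r n)⁻¹ • (φ g - cob1 π (y n) g)
  have hψ : ∀ n, IsCocycle π (ψ n) := fun n => (hφ.sub (isCocycle_cob1 π (y n))).smul _
  have hlower : ∀ (n : ℕ) (z : X), ‖z‖ ≤ n → 1 / 2 ≤ displacement π (ψ n) S z := by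
    intro n z hz
    have h1 := hy n (y n + r n • z) (by
      rw [add_sub_cancel_left, norm_smul, Real.norm_of_nonneg (hrpos n).le, mul_comm]
      exact mul_le_mul_of_nonneg_right hz (hrpos n).le)
    rw [displacement_smul_add (hrpos n)] at h1
    refine le_of_mul_le_mul_left ?_ (hrpos n)
    rw [mul_one_div]
    exact h1
  have hbound : ∀ g, ∃ C, ∀ n, ‖ψ n g‖ ≤ C := by
    refine exists_bound_of_generators hψ hπ hS fun s hs => ⟨1, fun n => ?_⟩
    rw [norm_smul, norm_inv, Real.norm_of_nonneg (hrpos n).le, inv_mul_le_iff₀ (hrpos n), mul_one]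
    exact Finset.single_le_sum (f := fun s => ‖φ s - cob1 π (y n) s‖)
      (fun s _ => norm_nonneg _) hs
  set ε : ℝ := 1 / (2 * (S.card + 1)) with hε
  obtain ⟨z, hsmall⟩ := h.exists_eventually_norm_sub_cob1_lt htor hπ hψ hbound S
    (by positivity : 0 < ε) (Filter.hyperfilter ℕ)
  have hlarge : ∀ᶠ n : ℕ in (Filter.hyperfilter ℕ : Filter ℕ), ‖z‖ ≤ n :=
    ((tendsto_natCast_atTop_atTop (R := ℝ)).eventually_ge_atTop ‖z‖).filter_mono
      Nat.hyperfilter_le_atTop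
  obtain ⟨n, h1, h2⟩ := (hsmall.and hlarge).exists
  have h3 := hlower n (z n) ((z.norm_coe_le_norm n).trans h2)
  have h4 : displacement π (ψ n) S (z n) ≤ S.card * ε := by
    rw [← nsmul_eq_mul]
    exact Finset.sum_le_card_nsmul _ _ _ fun s hs => (h1 s hs).le
  have h5 : S.card * ε < 1 / 2 := by
    rw [hε, mul_one_div, div_lt_div_iff₀ (by positivity) two_pos]
    linarith
  linarith

theorem VanishingH1UC.exists_norm_le (h : VanishingH1UC.{u} G)
    (hπ : ∀ (g : G) (x : X), ‖π g x‖ = ‖x‖) (h0 : ∀ x : X, (∀ g, π g x = x) → x = 0)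
    (S : Finset G) (hS : Subgroup.closure (S : Set G) = ⊤) :
    ∃ K : ℝ, 0 ≤ K ∧ ∀ x, ‖x‖ ≤ K * ‖coboundaryOn π S x‖ := by
  have hinj : Function.Injective (coboundaryOn π S) := by
    rw [injective_iff_map_eq_zero]
    intro x hx
    refine h0 x fun g => (sub_eq_zero.1 ?_).symm
    exact (isCocycle_cob1 π x).eq_zero_of_generators hπ hS
      (fun s hs => congrFun hx ⟨s, hs⟩) g
  have hclosed : IsClosed (Set.range (coboundaryOn π S)) := by
    refine isClosed_of_closure_subset fun f hf => ?_
    obtain ⟨u, hu, hlim⟩ := mem_closure_iff_seq_limit.1 hf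
    choose x hx using hu
    have hcauchy : ∀ g, CauchySeq fun n => cob1 π (x n) g := by
      intro g
      have hg := tendsto_zero_of_generators
        (F := (Filter.atTop ×ˢ Filter.atTop : Filter (ℕ × ℕ)))
        (φ := fun p g => cob1 π (x p.1) g - cob1 π (x p.2) g)
        (fun p => (isCocycle_cob1 π (x p.1)).sub (isCocycle_cob1 π (x p.2))) hπ hS (by
          intro s hs
          have hcs : CauchySeq fun n => cob1 π (x n) s := by
            have := ((continuous_apply (⟨s, hs⟩ : S)).tendsto f).comp hlim
            refine (this.congr fun n => ?_).cauchySeq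
            rw [Function.comp_apply, ← hx n, coboundaryOn_apply]
          rw [cauchySeq_iff_tendsto_dist_atTop_0, ← Filter.prod_atTop_atTop_eq] at hcs
          simpa only [dist_eq_norm] using hcs) g
      rw [cauchySeq_iff_tendsto_dist_atTop_0, ← Filter.prod_atTop_atTop_eq]
      simpa only [dist_eq_norm] using hg
    choose φ hφ using fun g => cauchySeq_tendsto_of_complete (hcauchy g)
    have hcoc : IsCocycle π φ := by
      intro a b
      refine tendsto_nhds_unique (hφ (a * b)) ?_
      refine ((((π a).continuous.tendsto _).comp (hφ b)).add (hφ a)).congr fun n => ?_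
      exact (isCocycle_cob1 π (x n) a b).symm
    obtain ⟨y, rfl⟩ := h X π hπ φ hcoc
    refine ⟨y, funext fun s => tendsto_nhds_unique (hφ s) ?_⟩
    refine (((continuous_apply s).tendsto f).comp hlim).congr fun n => ?_
    rw [Function.comp_apply, ← hx n, coboundaryOn_apply]
  obtain ⟨K, hK⟩ := (coboundaryOn π S).antilipschitz_of_injective_of_isClosed_range hinj hclosed
  exact ⟨K, K.2, fun x => hK.le_mul_norm (map_zero _) x⟩

theorem VanishingH1UC.propertyTUC (h : VanishingH1UC.{u} G)
    (S : Finset G) (hS : Subgroup.closure (S : Set G) = ⊤) : PropertyTUC.{u} G := by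
  intro X _ _ _ _ π hπ hinv
  have := isClosed_invariants π
  have := uniformConvexSpace_quotient (invariants π)
  obtain ⟨K, hK0, hK⟩ := h.exists_norm_le (X := X ⧸ invariants π)
    (π := quotientAction π (invariants π) map_mem_invariants)
    (norm_quotientAction hπ) (eq_zero_of_invariant_quotientAction hπ) S hS
  obtain ⟨v, hv, hlt⟩ := hinv S (1 / (K + 1)) (by positivity)
  have h1 : ‖coboundaryOn (quotientAction π (invariants π) map_mem_invariants) S v‖
      ≤ 1 / (K + 1) :=
    (pi_norm_le_iff_of_nonneg (by positivity)).2 fun s => (hlt s s.2).le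
  have h2 := (hK v).trans (mul_le_mul_of_nonneg_left h1 hK0)
  rw [hv, mul_one_div, one_le_div (by positivity)] at h2
  linarith

end Vanishing

/-- (Shalom-type theorem) For a finitely generated group `G` with no non-trivial
homomorphism to `ℤ`, conditions (1) and (2) above are equivalent, and they imply
property `(T_{UC})`. -/
theorem vanishing_iff_reduced_vanishing_and_TUC
    (Sgen : Finset G) (hgen : Subgroup.closure (Sgen : Set G) = ⊤)
    (hnoZ : ∀ c : G → ℤ, (∀ a b : G, c (a * b) = c a + c b) → c = 0) :
    (VanishingH1UC.{u} G ↔ VanishingReducedH1UC.{u} G) ∧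
    (VanishingH1UC.{u} G → PropertyTUC.{u} G) := by
  refine ⟨⟨fun h => ?_, fun h => ?_⟩, fun h => h.propertyTUC Sgen hgen⟩
  · intro X _ _ _ _ π hπ _ φ hφ
    obtain ⟨x, rfl⟩ := h X π hπ φ hφ
    exact subset_closure ⟨x, rfl⟩
  · exact h.vanishingH1UC (exists_pow_mem_commutator Sgen hgen hnoZ) Sgen hgen
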